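/- Let f be a continuous real function on an interval I ⊆ ℝ and let H be an infinite-dimensional complex Hilbert space. The following are equivalent: (i) f is operator convex on I; (ii) for each natural number n, f(Σ_{k=1}^n a_k* x_k a_k) ≤ Σ_{k=1}^n a_k* f(x_k) a_k for every n-tuple (x_1, …, x_n) of bounded self-adjoint operators on H with spectra contained in I and every n-tuple (a_1, …, a_n) of bounded operators on H with Σ_{k=1}^n a_k* a_k = 1; (iii) f(v* x v) ≤ v* f(x) v for every isometry v on H and every bounded self-adjoint operator x on H with spectrum contained in I; (iv) p f(p x p + s(1 − p)) p ≤ p f(x) p for every orthogonal projection p on H, every bounded self-adjoint operator x on H with spectrum contained in I, and every s ∈ I. -/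

import Mathlib

/-- A continuous real function `f` on an interval `I ⊆ ℝ` is *operator convex on `I`* if
`f(λx + (1−λ)y) ≤ λ f(x) + (1−λ) f(y)` in the Loewner order, for every `λ ∈ [0,1]` and every
pair of bounded self-adjoint operators `x, y` on an infinite-dimensional complex Hilbert space
with spectra contained in `I`; here `f(x)` is given by the continuous functional calculus. -/
def OperatorConvexOn (f : ℝ → ℝ) (I : Set ℝ) : Prop :=
  ∀ (H : Type) [NormedAddCommGroup H] [InnerProductSpace ℂ H] [CompleteSpace H],
    ¬ FiniteDimensional ℂ H →
      ∀ x y : H →L[ℂ] H, IsSelfAdjoint x → IsSelfAdjoint y →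
        spectrum ℝ x ⊆ I → spectrum ℝ y ⊆ I →
          ∀ t : ℝ, t ∈ Set.Icc (0 : ℝ) 1 →
            cfc f (t • x + (1 - t) • y) ≤ t • cfc f x + (1 - t) • cfc f y

open ContinuousLinearMap

section Intertwining
variable {E F : Type*} [NormedAddCommGroup E] [InnerProductSpace ℂ E] [CompleteSpace E]
  [NormedAddCommGroup F] [InnerProductSpace ℂ F] [CompleteSpace F]

omit [CompleteSpace E] [CompleteSpace F] in
theorem aeval_comp_of_intertwine {A : E →L[ℂ] E} {B : F →L[ℂ] F} {w : F →L[ℂ] E}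
    (h : A ∘L w = w ∘L B) (p : Polynomial ℝ) :
    Polynomial.aeval A p ∘L w = w ∘L Polynomial.aeval B p := by
  induction p using Polynomial.induction_on' with
  | add p q hp hq => simp [hp, hq, ContinuousLinearMap.add_comp, ContinuousLinearMap.comp_add]
  | monomial n c =>
    have hn : (A ^ n) ∘L w = w ∘L (B ^ n) := by
      induction n with
      | zero => ext; simp
      | succ n ih =>
        rw [pow_succ', pow_succ', mul_def, mul_def, comp_assoc, ih, ← comp_assoc, h, comp_assoc]
    have := congrArg (c • ·) hn
    simp only [Polynomial.aeval_monomial, Algebra.algebraMap_eq_smul_one, smul_mul_assoc, one_mul]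
    ext v
    have := congrArg (fun T => T v) this
    simpa using this

theorem norm_cfc_sub_aeval_le {A : E →L[ℂ] E} (hA : IsSelfAdjoint A) {a b : ℝ}
    (hs : spectrum ℝ A ⊆ Set.Icc a b) {f : ℝ → ℝ} (hf : ContinuousOn f (Set.Icc a b)) {ε : ℝ}
    (hε : 0 < ε) {p : Polynomial ℝ} (hp : ∀ x ∈ Set.Icc a b, |p.eval x - f x| < ε) :
    ‖cfc f A - Polynomial.aeval A p‖ ≤ ε := by
  rw [← cfc_polynomial p A hA, ← cfc_sub f _ A (hf.mono hs) (by fun_prop)]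
  refine norm_cfc_le hε.le fun x hx => ?_
  rw [Real.norm_eq_abs, abs_sub_comm]
  exact (hp x (hs hx)).le

theorem cfc_comp_of_intertwine {A : E →L[ℂ] E} {B : F →L[ℂ] F} (hA : IsSelfAdjoint A)
    (hB : IsSelfAdjoint B) {a b : ℝ} (hsA : spectrum ℝ A ⊆ Set.Icc a b)
    (hsB : spectrum ℝ B ⊆ Set.Icc a b) {f : ℝ → ℝ} (hf : ContinuousOn f (Set.Icc a b))
    {w : F →L[ℂ] E} (h : A ∘L w = w ∘L B) :
    cfc f A ∘L w = w ∘L cfc f B := by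
  rw [← sub_eq_zero, ← norm_le_zero_iff]
  have key : ∀ ε > 0, ‖cfc f A ∘L w - w ∘L cfc f B‖ ≤ ε * ‖w‖ + ‖w‖ * ε := fun ε hε => by
    obtain ⟨p, hp⟩ := exists_polynomial_near_of_continuousOn a b f hf ε hε
    have e : cfc f A ∘L w - w ∘L cfc f B =
        (cfc f A - Polynomial.aeval A p) ∘L w - w ∘L (cfc f B - Polynomial.aeval B p) := by
      rw [sub_comp, comp_sub, aeval_comp_of_intertwine h]; abel
    rw [e]
    refine (norm_sub_le _ _).trans (add_le_add ?_ ?_)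
    · exact (opNorm_comp_le _ _).trans (mul_le_mul_of_nonneg_right
        (norm_cfc_sub_aeval_le hA hsA hf hε hp) (norm_nonneg _))
    · exact (opNorm_comp_le _ _).trans (mul_le_mul_of_nonneg_left
        (norm_cfc_sub_aeval_le hB hsB hf hε hp) (norm_nonneg _))
  refine le_of_forall_pos_le_add fun δ hδ => (key (δ / (2 * (‖w‖ + 1))) (by positivity)).trans ?_
  rw [zero_add, mul_comm ‖w‖, ← two_mul, ← mul_assoc, mul_div_assoc',
    mul_div_mul_left _ _ two_ne_zero, div_mul_eq_mul_div, div_le_iff₀ (by positivity)]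
  nlinarith [norm_nonneg w]

theorem spectrum_subset_Icc_iff {A : E →L[ℂ] E} (hA : IsSelfAdjoint A) {a b : ℝ} :
    spectrum ℝ A ⊆ Set.Icc a b ↔ 0 ≤ A - a • 1 ∧ 0 ≤ b • 1 - A := by
  rw [sub_nonneg, sub_nonneg, ← Algebra.algebraMap_eq_smul_one, ← Algebra.algebraMap_eq_smul_one,
    algebraMap_le_iff_le_spectrum (ha := hA), le_algebraMap_iff_spectrum_le (ha := hA)]
  exact ⟨fun h => ⟨fun x hx => (h hx).1, fun x hx => (h hx).2⟩, fun h x hx => ⟨h.1 x hx, h.2 x hx⟩⟩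

theorem conj_adjoint_nonneg {T : E →L[ℂ] E} (hT : 0 ≤ T) (S : E →L[ℂ] F) :
    0 ≤ S ∘L T ∘L adjoint S :=
  (nonneg_iff_isPositive _).2 (((nonneg_iff_isPositive _).1 hT).conj_adjoint S)

theorem adjoint_conj_nonneg {T : E →L[ℂ] E} (hT : 0 ≤ T) (S : F →L[ℂ] E) :
    0 ≤ adjoint S ∘L T ∘L S :=
  (nonneg_iff_isPositive _).2 (((nonneg_iff_isPositive _).1 hT).adjoint_conj S)

/-- The projection onto the orthogonal complement of the ranges of the partial isometries `w k`. -/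
noncomputable def complProj {ι : Type*} [Fintype ι] (w : ι → E →L[ℂ] F) : F →L[ℂ] F :=
  1 - ∑ k, w k ∘L adjoint (w k)

/-- The operators `x k` carried over to another space along the partial isometries `w k`, and
padded by the scalar `a` on the complement of their ranges. -/
noncomputable def dilation {ι : Type*} [Fintype ι] (w : ι → E →L[ℂ] F) (a : ℝ)
    (x : ι → E →L[ℂ] E) : F →L[ℂ] F :=
  ∑ k, w k ∘L x k ∘L adjoint (w k) + a • complProj w

section Dilation
variable {ι : Type*} [Fintype ι] {w : ι → E →L[ℂ] F}

theorem complProj_comp (horth : ∀ j k, j ≠ k → adjoint (w j) ∘L w k = 0)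
    (hw : ∀ k, w k ∘L adjoint (w k) ∘L w k = w k) (k : ι) : complProj w ∘L w k = 0 := by
  classical
  rw [complProj, sub_comp, finsetSum_comp, Finset.sum_eq_single k]
  · rw [comp_assoc, hw]; ext; simp
  · intro j _ hjk; rw [comp_assoc, horth j k hjk, comp_zero]
  · simp

theorem isSelfAdjoint_complProj : IsSelfAdjoint (complProj w) := by
  refine (IsSelfAdjoint.one _).sub (isSelfAdjoint_sum _ fun k _ => ?_)
  rw [isSelfAdjoint_iff', adjoint_comp, adjoint_adjoint]

theorem complProj_nonneg (horth : ∀ j k, j ≠ k → adjoint (w j) ∘L w k = 0)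
    (hw : ∀ k, w k ∘L adjoint (w k) ∘L w k = w k) : 0 ≤ complProj w := by
  have h0 : complProj w * ∑ k, w k ∘L adjoint (w k) = 0 := by
    rw [Finset.mul_sum]
    refine Finset.sum_eq_zero fun k _ => ?_
    rw [mul_def, ← comp_assoc, complProj_comp horth hw, zero_comp]
  have hqq : complProj w * complProj w = complProj w := by
    calc complProj w * complProj w = complProj w * (1 - ∑ k, w k ∘L adjoint (w k)) := rfl
      _ = complProj w := by rw [mul_sub, h0, mul_one, sub_zero]
  have := star_mul_self_nonneg (complProj w)
  rwa [isSelfAdjoint_complProj.star_eq, hqq] at this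

theorem smul_one_eq_sum_add_complProj (w : ι → E →L[ℂ] F) (c : ℝ) :
    c • (1 : F →L[ℂ] F) =
      ∑ k, w k ∘L (c • (1 : E →L[ℂ] E)) ∘L adjoint (w k) + c • complProj w := by
  have : ∑ k, w k ∘L (c • (1 : E →L[ℂ] E)) ∘L adjoint (w k) = c • ∑ k, w k ∘L adjoint (w k) := by
    rw [Finset.smul_sum]
    refine Finset.sum_congr rfl fun k _ => ?_
    ext v
    simp
  rw [this, ← smul_add, complProj, add_sub_cancel]

theorem isSelfAdjoint_dilation {a : ℝ} {x : ι → E →L[ℂ] E} (hx : ∀ k, IsSelfAdjoint (x k)) :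
    IsSelfAdjoint (dilation w a x) :=
  (isSelfAdjoint_sum _ fun k _ => (hx k).conj_adjoint (w k)).add
    ((IsSelfAdjoint.all a).smul isSelfAdjoint_complProj)

theorem spectrum_dilation_subset (horth : ∀ j k, j ≠ k → adjoint (w j) ∘L w k = 0)
    (hw : ∀ k, w k ∘L adjoint (w k) ∘L w k = w k) {a b : ℝ} (hab : a ≤ b)
    {x : ι → E →L[ℂ] E} (hx : ∀ k, IsSelfAdjoint (x k))
    (hs : ∀ k, spectrum ℝ (x k) ⊆ Set.Icc a b) :
    spectrum ℝ (dilation w a x) ⊆ Set.Icc a b := by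
  rw [spectrum_subset_Icc_iff (isSelfAdjoint_dilation hx)]
  have hs' := fun k => (spectrum_subset_Icc_iff (hx k)).1 (hs k)
  constructor
  · have : dilation w a x - a • 1 = ∑ k, w k ∘L (x k - a • 1) ∘L adjoint (w k) := by
      rw [smul_one_eq_sum_add_complProj w a, dilation, add_sub_add_right_eq_sub]
      simp only [sub_comp, comp_sub, Finset.sum_sub_distrib]
    rw [this]
    exact Finset.sum_nonneg fun k _ => conj_adjoint_nonneg (hs' k).1 _
  · have : b • 1 - dilation w a x =
        ∑ k, w k ∘L (b • 1 - x k) ∘L adjoint (w k) + (b - a) • complProj w := by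
      rw [smul_one_eq_sum_add_complProj w b, dilation, add_sub_add_comm, sub_smul]
      simp only [sub_comp, comp_sub, Finset.sum_sub_distrib]
    rw [this]
    exact add_nonneg (Finset.sum_nonneg fun k _ => conj_adjoint_nonneg (hs' k).2 _)
      (smul_nonneg (sub_nonneg.2 hab) (complProj_nonneg horth hw))

theorem dilation_comp (horth : ∀ j k, j ≠ k → adjoint (w j) ∘L w k = 0)
    (hw : ∀ k, w k ∘L adjoint (w k) ∘L w k = w k) (a : ℝ) {x : ι → E →L[ℂ] E}
    (hx : ∀ k, (adjoint (w k) ∘L w k) ∘L x k = x k ∘L (adjoint (w k) ∘L w k)) (k : ι) :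
    dilation w a x ∘L w k = w k ∘L x k := by
  classical
  rw [dilation, add_comp, smul_comp, complProj_comp horth hw, smul_zero, add_zero, finsetSum_comp,
    Finset.sum_eq_single k]
  · rw [comp_assoc, comp_assoc, ← hx k, ← comp_assoc, hw]
  · intro j _ hjk; rw [comp_assoc, comp_assoc, horth j k hjk, comp_zero, comp_zero]
  · simp

end Dilation
end Intertwining

section Jensen
variable {E F : Type*} [NormedAddCommGroup E] [InnerProductSpace ℂ E] [CompleteSpace E]
  [NormedAddCommGroup F] [InnerProductSpace ℂ F] [CompleteSpace F]

theorem spectrum_adjoint_conj_subset {x : E →L[ℂ] E} (hx : IsSelfAdjoint x) {a b : ℝ}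
    (hs : spectrum ℝ x ⊆ Set.Icc a b) {v : F →L[ℂ] E} (hv : adjoint v ∘L v = 1) :
    spectrum ℝ (adjoint v ∘L x ∘L v) ⊆ Set.Icc a b := by
  have hc : ∀ c : ℝ, c • (1 : F →L[ℂ] F) = adjoint v ∘L (c • (1 : E →L[ℂ] E)) ∘L v := fun c => by
    rw [← hv]; ext; simp
  rw [spectrum_subset_Icc_iff (hx.adjoint_conj v), hc a, hc b, ← comp_sub, ← comp_sub, ← sub_comp,
    ← sub_comp]
  obtain ⟨h1, h2⟩ := (spectrum_subset_Icc_iff hx).1 hs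
  exact ⟨adjoint_conj_nonneg h1 v, adjoint_conj_nonneg h2 v⟩

theorem isSelfAdjoint_convex_comb {x y : E →L[ℂ] E} (hx : IsSelfAdjoint x)
    (hy : IsSelfAdjoint y) (t : ℝ) : IsSelfAdjoint (t • x + (1 - t) • y) :=
  ((IsSelfAdjoint.all t).smul hx).add ((IsSelfAdjoint.all (1 - t)).smul hy)

theorem spectrum_convex_comb_subset {x y : E →L[ℂ] E} (hx : IsSelfAdjoint x)
    (hy : IsSelfAdjoint y) {a b : ℝ} (hsx : spectrum ℝ x ⊆ Set.Icc a b)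
    (hsy : spectrum ℝ y ⊆ Set.Icc a b) {t : ℝ} (ht : t ∈ Set.Icc (0 : ℝ) 1) :
    spectrum ℝ (t • x + (1 - t) • y) ⊆ Set.Icc a b := by
  obtain ⟨h1, h2⟩ := (spectrum_subset_Icc_iff hx).1 hsx
  obtain ⟨h3, h4⟩ := (spectrum_subset_Icc_iff hy).1 hsy
  rw [spectrum_subset_Icc_iff (isSelfAdjoint_convex_comb hx hy t)]
  constructor
  · have : t • x + (1 - t) • y - a • 1 = t • (x - a • 1) + (1 - t) • (y - a • 1) := by module
    rw [this]
    exact add_nonneg (smul_nonneg ht.1 h1) (smul_nonneg (sub_nonneg.2 ht.2) h3)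
  · have : b • 1 - (t • x + (1 - t) • y) = t • (b • 1 - x) + (1 - t) • (b • 1 - y) := by module
    rw [this]
    exact add_nonneg (smul_nonneg ht.1 h2) (smul_nonneg (sub_nonneg.2 ht.2) h4)

theorem exists_Icc_of_spectrum_subset [Nontrivial E] {ι : Type*} [Finite ι] [Nonempty ι]
    {I : Set ℝ} (hI : I.OrdConnected) {x : ι → E →L[ℂ] E} (hx : ∀ k, IsSelfAdjoint (x k))
    (hs : ∀ k, spectrum ℝ (x k) ⊆ I) :
    ∃ a b : ℝ, a ≤ b ∧ Set.Icc a b ⊆ I ∧ ∀ k, spectrum ℝ (x k) ⊆ Set.Icc a b := by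
  set S : Set ℝ := ⋃ k, spectrum ℝ (x k)
  have hc : IsCompact S := isCompact_iUnion fun k => spectrum.isCompact (x k)
  have hne : S.Nonempty := by
    obtain ⟨k⟩ := ‹Nonempty ι›
    obtain ⟨r, hr⟩ := ContinuousFunctionalCalculus.spectrum_nonempty (R := ℝ) (x k) (hx k)
    exact ⟨r, Set.mem_iUnion.2 ⟨k, hr⟩⟩
  have hSI : S ⊆ I := Set.iUnion_subset hs
  refine ⟨sInf S, sSup S, csInf_le_csSup hne hc.bddBelow hc.bddAbove,
    hI.out (hSI (hc.sInf_mem hne)) (hSI (hc.sSup_mem hne)), fun k r hr => ?_⟩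
  have : r ∈ S := Set.mem_iUnion.2 ⟨k, hr⟩
  exact ⟨csInf_le hc.bddBelow this, le_csSup hc.bddAbove this⟩

/-- The operator convexity inequality for `f` on the space `E`. -/
def OperatorConvexAt (f : ℝ → ℝ) (I : Set ℝ) (E : Type*) [NormedAddCommGroup E]
    [InnerProductSpace ℂ E] [CompleteSpace E] : Prop :=
  ∀ x y : E →L[ℂ] E, IsSelfAdjoint x → IsSelfAdjoint y →
    spectrum ℝ x ⊆ I → spectrum ℝ y ⊆ I → ∀ t : ℝ, t ∈ Set.Icc (0 : ℝ) 1 →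
      cfc f (t • x + (1 - t) • y) ≤ t • cfc f x + (1 - t) • cfc f y

/-- Jensen's operator inequality for `f` and isometries from `F` to `E`. -/
def IsometricJensen (f : ℝ → ℝ) (I : Set ℝ) (F E : Type*) [NormedAddCommGroup E]
    [InnerProductSpace ℂ E] [CompleteSpace E] [NormedAddCommGroup F] [InnerProductSpace ℂ F]
    [CompleteSpace F] : Prop :=
  ∀ (v : F →L[ℂ] E) (x : E →L[ℂ] E), adjoint v ∘L v = 1 → IsSelfAdjoint x → spectrum ℝ x ⊆ I →
    cfc f (adjoint v ∘L x ∘L v) ≤ adjoint v ∘L cfc f x ∘L v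

variable {f : ℝ → ℝ} {I : Set ℝ}

theorem OperatorConvexAt.isometricJensen [Nontrivial E] (hI : I.OrdConnected)
    (hf : ContinuousOn f I) (h : OperatorConvexAt f I E) : IsometricJensen f I F E := by
  intro v x hv hx hs
  obtain ⟨a, b, hab, hIcc, hs'⟩ := exists_Icc_of_spectrum_subset (ι := Unit) hI
    (x := fun _ => x) (fun _ => hx) (fun _ => hs)
  replace hs' := hs' ()
  have hfc := hf.mono hIcc
  set p : E →L[ℂ] E := v ∘L adjoint v with hp
  set u : E →L[ℂ] E := (2 : ℝ) • p - 1 with hu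
  have hpsa : IsSelfAdjoint p := by rw [isSelfAdjoint_iff', hp, adjoint_comp, adjoint_adjoint]
  have husa : IsSelfAdjoint u := ((IsSelfAdjoint.all (2 : ℝ)).smul hpsa).sub (IsSelfAdjoint.one _)
  have hpv : p ∘L v = v := by rw [hp, comp_assoc, hv]; rfl
  have hpp : p * p = p := by
    calc p * p = (p ∘L v) ∘L adjoint v := rfl
      _ = p := by rw [hpv]
  have huu : u * u = 1 := by
    have : u * u = (4 : ℝ) • (p * p) - (4 : ℝ) • p + 1 := by
      rw [hu]; simp only [sub_mul, mul_sub, smul_mul_assoc, mul_smul_comm, mul_one, one_mul]; module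
    rw [this, hpp, sub_self, zero_add]
  have huv : u ∘L v = v := by
    rw [hu, sub_comp, smul_comp, hpv]
    ext z; simp [two_smul]
  have hvu : adjoint v ∘L u = adjoint v := by
    have := congrArg adjoint huv
    rwa [adjoint_comp, (isSelfAdjoint_iff'.1 husa)] at this
  have hadj : adjoint u ∘L u = 1 := by rw [isSelfAdjoint_iff'.1 husa]; exact huu
  set x' : E →L[ℂ] E := adjoint u ∘L x ∘L u with hx'
  have hx'sa : IsSelfAdjoint x' := hx.adjoint_conj u
  have hx's : spectrum ℝ x' ⊆ Set.Icc a b := spectrum_adjoint_conj_subset hx hs' hadj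
  have hx'u : x' ∘L u = u ∘L x := by
    rw [hx', isSelfAdjoint_iff'.1 husa, comp_assoc, comp_assoc, ← mul_def u u, huu]; rfl
  have hfx' : cfc f x' = u ∘L cfc f x ∘L u := by
    have := cfc_comp_of_intertwine hx'sa hx hx's hs' hfc hx'u
    rw [← comp_assoc, ← this, comp_assoc, ← mul_def u u, huu]; rfl
  have ht : (1 / 2 : ℝ) ∈ Set.Icc (0 : ℝ) 1 := by constructor <;> norm_num
  have hconv := h x x' hx hx'sa hs (hx's.trans hIcc) _ ht
  set y : E →L[ℂ] E := (1 / 2 : ℝ) • x + (1 - 1 / 2 : ℝ) • x' with hy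
  have hysa : IsSelfAdjoint y := isSelfAdjoint_convex_comb hx hx'sa _
  have hyv : y ∘L v = v ∘L (adjoint v ∘L x ∘L v) := by
    have h1 : x' ∘L v = u ∘L x ∘L v := by
      rw [hx', isSelfAdjoint_iff'.1 husa, comp_assoc, comp_assoc, huv]
    rw [hy, add_comp, smul_comp, smul_comp, h1, hu, sub_comp, hp]
    ext z
    simp
    module
  have hfy := cfc_comp_of_intertwine hysa (hx.adjoint_conj v)
    (spectrum_convex_comb_subset hx hx'sa hs' hx's ht) (spectrum_adjoint_conj_subset hx hs' hv)
    hfc hyv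
  have e1 : cfc f (adjoint v ∘L x ∘L v) = adjoint v ∘L cfc f y ∘L v := by
    rw [hfy, ← comp_assoc (adjoint v) v, hv]; rfl
  have e2 : adjoint v ∘L cfc f x ∘L v =
      adjoint v ∘L ((1 / 2 : ℝ) • cfc f x + (1 - 1 / 2 : ℝ) • cfc f x') ∘L v := by
    have h1 : adjoint v ∘L cfc f x' ∘L v = adjoint v ∘L cfc f x ∘L v := by
      rw [hfx', comp_assoc, comp_assoc, huv, ← comp_assoc, hvu]
    rw [add_comp, comp_add, smul_comp, smul_comp, comp_smul, comp_smul, h1, ← add_smul]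
    norm_num
  rw [e1, e2, ← sub_nonneg, ← comp_sub, ← sub_comp]
  exact adjoint_conj_nonneg (sub_nonneg.2 hconv) v

/-- Jensen's operator inequality for columns follows from the one for isometries into a space
that contains enough mutually orthogonal copies of the given one. -/
theorem IsometricJensen.sum_le [Nontrivial F] (hI : I.OrdConnected) (hf : ContinuousOn f I)
    (h : IsometricJensen f I F E) {ι : Type*} [Fintype ι] [Nonempty ι] {w : ι → F →L[ℂ] E}
    (horth : ∀ j k, j ≠ k → adjoint (w j) ∘L w k = 0) (hw : ∀ k, adjoint (w k) ∘L w k = 1)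
    {x a : ι → F →L[ℂ] F} (hx : ∀ k, IsSelfAdjoint (x k)) (hs : ∀ k, spectrum ℝ (x k) ⊆ I)
    (ha : ∑ k, adjoint (a k) ∘L a k = 1) :
    cfc f (∑ k, adjoint (a k) ∘L x k ∘L a k) ≤ ∑ k, adjoint (a k) ∘L cfc f (x k) ∘L a k := by
  classical
  obtain ⟨c, d, hcd, hIcc, hs'⟩ := exists_Icc_of_spectrum_subset hI hx hs
  have hfc := hf.mono hIcc
  have hw' : ∀ k, w k ∘L adjoint (w k) ∘L w k = w k := fun k => by rw [hw]; rfl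
  have hcomm : ∀ k, (adjoint (w k) ∘L w k) ∘L x k = x k ∘L (adjoint (w k) ∘L w k) := fun k => by
    rw [hw]; rfl
  set X := dilation w c x
  have hXsa : IsSelfAdjoint X := isSelfAdjoint_dilation hx
  have hXs : spectrum ℝ X ⊆ Set.Icc c d := spectrum_dilation_subset horth hw' hcd hx hs'
  have hXw : ∀ k, X ∘L w k = w k ∘L x k := dilation_comp horth hw' c hcomm
  have hfXw := fun k => cfc_comp_of_intertwine hXsa (hx k) hXs (hs' k) hfc (hXw k)
  set v : F →L[ℂ] E := ∑ k, w k ∘L a k with hv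
  have key : ∀ (T : E →L[ℂ] E) (S : ι → F →L[ℂ] F), (∀ k, T ∘L w k = w k ∘L S k) →
      adjoint v ∘L T ∘L v = ∑ k, adjoint (a k) ∘L S k ∘L a k := fun T S hTS => by
    rw [hv, map_sum, finsetSum_comp]
    refine Finset.sum_congr rfl fun j _ => ?_
    rw [comp_finsetSum, comp_finsetSum, Finset.sum_eq_single j]
    · rw [adjoint_comp, ← comp_assoc T, hTS, comp_assoc, comp_assoc, ← comp_assoc _ (w j), hw]; rfl
    · intro k _ hkj
      rw [adjoint_comp, ← comp_assoc T, hTS, comp_assoc, comp_assoc, ← comp_assoc _ (w k),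
        horth j k hkj.symm, zero_comp, comp_zero]
    · simp
  have hvv : adjoint v ∘L v = 1 := by
    have := key 1 (fun _ => 1) (fun k => by ext; simp)
    rw [← ha]
    exact this
  have := h v X hvv hXsa (hXs.trans hIcc)
  rwa [key X x hXw, key _ _ hfXw] at this

/-- Operator convexity passes from `E` to `F` if, locally, `F` embeds into `E` along partial
isometries whose initial projections commute with the operators concerned. -/
theorem OperatorConvexAt.of_partialIsometry [Nontrivial F] (hI : I.OrdConnected)
    (hf : ContinuousOn f I) (h : OperatorConvexAt f I E)
    (hloc : ∀ (x y : F →L[ℂ] F), IsSelfAdjoint x → IsSelfAdjoint y → ∀ ξ : F,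
      ∃ w : F →L[ℂ] E, w ∘L adjoint w ∘L w = w ∧
        (adjoint w ∘L w) ∘L x = x ∘L (adjoint w ∘L w) ∧
        (adjoint w ∘L w) ∘L y = y ∘L (adjoint w ∘L w) ∧ adjoint w (w ξ) = ξ) :
    OperatorConvexAt f I F := by
  intro x y hx hy hsx hsy t ht
  obtain ⟨a, b, hab, hIcc, hs⟩ := exists_Icc_of_spectrum_subset (ι := Bool) hI
    (x := fun k => cond k x y) (by simp [hx, hy]) (by simp [hsx, hsy])
  have hsx' : spectrum ℝ x ⊆ Set.Icc a b := hs true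
  have hsy' : spectrum ℝ y ⊆ Set.Icc a b := hs false
  have hfc := hf.mono hIcc
  rw [ContinuousLinearMap.le_def, isPositive_def']
  refine ⟨(isSelfAdjoint_convex_comb (cfc_predicate f x) (cfc_predicate f y) t).sub
    (cfc_predicate f _), fun ξ => ?_⟩
  obtain ⟨w, hw, hwx, hwy, hξ⟩ := hloc x y hx hy ξ
  have horth : ∀ j k : Unit, j ≠ k → adjoint w ∘L w = 0 := fun _ _ hjk => (hjk rfl).elim
  have dil : ∀ z : F →L[ℂ] F, IsSelfAdjoint z → spectrum ℝ z ⊆ Set.Icc a b →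
      (adjoint w ∘L w) ∘L z = z ∘L (adjoint w ∘L w) →
      ∃ Z : E →L[ℂ] E, IsSelfAdjoint Z ∧ spectrum ℝ Z ⊆ Set.Icc a b ∧ Z ∘L w = w ∘L z :=
    fun z hz hsz hwz => ⟨dilation (fun _ : Unit => w) a (fun _ => z),
      isSelfAdjoint_dilation fun _ => hz,
      spectrum_dilation_subset horth (fun _ => hw) hab (fun _ => hz) fun _ => hsz,
      dilation_comp horth (fun _ => hw) a (fun _ => hwz) ()⟩
  obtain ⟨X, hX, hsX, hXw⟩ := dil x hx hsx' hwx
  obtain ⟨Y, hY, hsY, hYw⟩ := dil y hy hsy' hwy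
  have hconv := h X Y hX hY (hsX.trans hIcc) (hsY.trans hIcc) t ht
  have hZw : (t • X + (1 - t) • Y) ∘L w = w ∘L (t • x + (1 - t) • y) := by
    simp only [add_comp, comp_add, smul_comp, comp_smul, hXw, hYw]
  have hfX := cfc_comp_of_intertwine hX hx hsX hsx' hfc hXw
  have hfY := cfc_comp_of_intertwine hY hy hsY hsy' hfc hYw
  have hfZ := cfc_comp_of_intertwine (isSelfAdjoint_convex_comb hX hY t)
    (isSelfAdjoint_convex_comb hx hy t) (spectrum_convex_comb_subset hX hY hsX hsY ht)
    (spectrum_convex_comb_subset hx hy hsx' hsy' ht) hfc hZw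
  have hpos := ((ContinuousLinearMap.le_def _ _).1 hconv).re_inner_nonneg_left (w ξ)
  have hT : (t • cfc f X + (1 - t) • cfc f Y - cfc f (t • X + (1 - t) • Y)) ∘L w =
      w ∘L (t • cfc f x + (1 - t) • cfc f y - cfc f (t • x + (1 - t) • y)) := by
    simp only [add_comp, comp_add, smul_comp, comp_smul, sub_comp, comp_sub, hfX, hfY, hfZ]
  rw [← comp_apply, hT, comp_apply, ← adjoint_inner_right, hξ] at hpos
  exact hpos
end Jensen

section Embedding
variable {E F : Type*} [NormedAddCommGroup E] [InnerProductSpace ℂ E] [CompleteSpace E]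
  [NormedAddCommGroup F] [InnerProductSpace ℂ F] [CompleteSpace F]

omit [CompleteSpace F] in
theorem HilbertBasis.exists_linearIsometry {ι : Type*} (b : HilbertBasis ι ℂ F) {e : ι → E}
    (he : Orthonormal ℂ e) : ∃ J : F →ₗᵢ[ℂ] E, ∀ i, J (b i) = e i := by
  classical
  refine ⟨he.orthogonalFamily.linearIsometry.comp b.repr.toLinearIsometry, fun i => ?_⟩
  exact (congrArg _ (b.repr_self i)).trans
    ((he.orthogonalFamily.linearIsometry_apply_single 1).trans (by simp))

omit [CompleteSpace F] in
theorem HilbertBasis.countable {ι : Type*} [TopologicalSpace.SeparableSpace F]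
    (b : HilbertBasis ι ℂ F) : Countable ι := by
  have hd : ∀ i j, i ≠ j → 1 ≤ dist (b i) (b j) := fun i j hij => by
    have h := norm_sub_sq (𝕜 := ℂ) (b i) (b j)
    rw [b.orthonormal.1 i, b.orthonormal.1 j, b.orthonormal.2 hij] at h
    rw [dist_eq_norm]
    norm_num at h
    nlinarith [norm_nonneg (b i - b j)]
  have hdisj : (Set.univ : Set ι).PairwiseDisjoint fun i => Metric.ball (b i) (1 / 2) :=
    fun i _ j _ hij => Metric.ball_disjoint_ball (by norm_num; exact hd i j hij)
  exact Set.countable_univ_iff.1 (hdisj.countable_of_isOpen (fun _ _ => Metric.isOpen_ball)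
    fun i _ => ⟨b i, Metric.mem_ball_self (by norm_num)⟩)

omit [CompleteSpace F] in
theorem HilbertBasis.infinite {ι : Type*} (b : HilbertBasis ι ℂ F)
    (hdim : ¬ FiniteDimensional ℂ F) : Infinite ι := by
  by_contra h
  rw [not_infinite_iff_finite] at h
  have := Fintype.ofFinite ι
  exact hdim b.toOrthonormalBasis.toBasis.finiteDimensional_of_finite

theorem exists_orthogonal_isometries (hdim : ¬ FiniteDimensional ℂ E) :
    ∃ w : Bool → E →L[ℂ] E, (∀ j k, j ≠ k → adjoint (w j) ∘L w k = 0) ∧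
      ∀ k, adjoint (w k) ∘L w k = 1 := by
  obtain ⟨s, b, -⟩ := exists_hilbertBasis ℂ E
  have := b.infinite hdim
  obtain ⟨g⟩ : Nonempty (s ⊕ s ≃ s) := by
    rw [← Cardinal.eq, ← Cardinal.add_def]
    exact Cardinal.add_eq_self (Cardinal.aleph0_le_mk s)
  have horth : ∀ (h : s → s), Function.Injective h → Orthonormal ℂ (b ∘ h) := fun h hh =>
    b.orthonormal.comp h hh
  obtain ⟨J, hJ⟩ := b.exists_linearIsometry (horth _ (g.injective.comp Sum.inl_injective))
  obtain ⟨K, hK⟩ := b.exists_linearIsometry (horth _ (g.injective.comp Sum.inr_injective))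
  have hJK : adjoint J.toContinuousLinearMap ∘L K.toContinuousLinearMap = 0 := by
    refine ContinuousLinearMap.ext_on
      (Submodule.dense_iff_topologicalClosure_eq_top.2 b.dense_span) ?_
    rintro _ ⟨i, rfl⟩
    refine b.repr.injective ?_
    ext j
    simp only [HilbertBasis.repr_apply_apply, comp_apply, adjoint_inner_right,
      LinearIsometry.coe_toContinuousLinearMap, hJ, hK, Function.comp]
    simpa using b.orthonormal.2 (fun h => by simpa using g.injective h)
  have hKJ : adjoint K.toContinuousLinearMap ∘L J.toContinuousLinearMap = 0 := by
    have := congrArg adjoint hJK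
    rwa [adjoint_comp, adjoint_adjoint, map_zero] at this
  refine ⟨fun k => cond k J.toContinuousLinearMap K.toContinuousLinearMap, ?_, ?_⟩
  · rintro (_ | _) (_ | _) h
    exacts [(h rfl).elim, hKJ, hJK, (h rfl).elim]
  · rintro (_ | _)
    exacts [K.adjoint_comp_self, J.adjoint_comp_self]

theorem starProjection_comp_comm (L : Submodule ℂ F) [L.HasOrthogonalProjection]
    {x : F →L[ℂ] F} (hx : IsSelfAdjoint x) (hL : ∀ v ∈ L, x v ∈ L) :
    L.starProjection ∘L x = x ∘L L.starProjection := by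
  have h1 : L.starProjection ∘L x ∘L L.starProjection = x ∘L L.starProjection := by
    ext v
    exact Submodule.starProjection_eq_self_iff.2 (hL _ (Submodule.starProjection_apply_mem L v))
  have h2 := congrArg adjoint h1
  have hP : adjoint L.starProjection = L.starProjection :=
    isSelfAdjoint_iff'.1 (isSelfAdjoint_starProjection L)
  rw [adjoint_comp, adjoint_comp, hP, isSelfAdjoint_iff'.1 hx, comp_assoc, h1] at h2
  exact h2.symm

omit [CompleteSpace F] in
/-- Any vector lies in a closed separable subspace that is invariant under two given operators. -/
theorem exists_separable_invariant (x y : F →L[ℂ] F) (ξ : F) :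
    ∃ L : Submodule ℂ F, IsClosed (L : Set F) ∧ TopologicalSpace.IsSeparable (L : Set F) ∧
      ξ ∈ L ∧ (∀ v ∈ L, x v ∈ L) ∧ ∀ v ∈ L, y v ∈ L := by
  set word : List Bool → F := fun l => l.foldr (fun k v => (cond k x y) v) ξ
  have hinv : ∀ k : Bool, ∀ v ∈ (Submodule.span ℂ (Set.range word)).topologicalClosure,
      (cond k x y) v ∈ (Submodule.span ℂ (Set.range word)).topologicalClosure := fun k => by
    set z : F →L[ℂ] F := cond k x y with hz
    have : Submodule.span ℂ (Set.range word) ≤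
        (Submodule.span ℂ (Set.range word)).comap (z : F →ₗ[ℂ] F) := by
      rw [Submodule.span_le]
      rintro _ ⟨l, rfl⟩
      exact Submodule.subset_span ⟨k :: l, rfl⟩
    intro v hv
    exact map_mem_closure z.continuous hv fun u hu => this hu
  refine ⟨(Submodule.span ℂ (Set.range word)).topologicalClosure,
    Submodule.isClosed_topologicalClosure _, ?_, ?_, hinv true, hinv false⟩
  · exact ((Set.countable_range word).isSeparable.span (R := ℂ)).closure
  · exact Submodule.le_topologicalClosure _ (Submodule.subset_span ⟨[], rfl⟩)

theorem exists_partialIsometry (hdim : ¬ FiniteDimensional ℂ E) {x y : F →L[ℂ] F}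
    (hx : IsSelfAdjoint x) (hy : IsSelfAdjoint y) (ξ : F) :
    ∃ w : F →L[ℂ] E, w ∘L adjoint w ∘L w = w ∧
      (adjoint w ∘L w) ∘L x = x ∘L (adjoint w ∘L w) ∧
      (adjoint w ∘L w) ∘L y = y ∘L (adjoint w ∘L w) ∧ adjoint w (w ξ) = ξ := by
  obtain ⟨L, hLc, hLs, hξ, hLx, hLy⟩ := exists_separable_invariant x y ξ
  have : CompleteSpace L := hLc.completeSpace_coe
  have : TopologicalSpace.SeparableSpace L := hLs.separableSpace
  obtain ⟨s, b, -⟩ := exists_hilbertBasis ℂ E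
  have := b.infinite hdim
  obtain ⟨r, c, -⟩ := exists_hilbertBasis ℂ L
  have := c.countable
  obtain ⟨g, hg⟩ := exists_injective_nat r
  obtain ⟨J, -⟩ := c.exists_linearIsometry
    (b.orthonormal.comp _ ((Infinite.natEmbedding s).injective.comp hg))
  set w : F →L[ℂ] E := J.toContinuousLinearMap ∘L L.orthogonalProjectionOnto with hw
  have hww : adjoint w ∘L w = L.starProjection := by
    rw [hw, adjoint_comp, comp_assoc, ← comp_assoc _ J.toContinuousLinearMap,
      J.adjoint_comp_self, Submodule.adjoint_orthogonalProjectionOnto]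
    rfl
  refine ⟨w, ?_, ?_, ?_, ?_⟩
  · rw [hww, hw]
    ext v
    exact congrArg J (Submodule.orthogonalProjectionOnto_mem_subspace_eq_self
      (L.orthogonalProjectionOnto v))
  · rw [hww]; exact starProjection_comp_comm L hx hLx
  · rw [hww]; exact starProjection_comp_comm L hy hLy
  · rw [← comp_apply, hww]; exact Submodule.starProjection_eq_self_iff.2 hξ

/-- The inclusion of a space as the `k`-th summand of its `n`-fold Hilbert sum. -/
noncomputable def hilbertSumInclusion (E : Type*) [NormedAddCommGroup E] [InnerProductSpace ℂ E]
    (n : ℕ) (k : Fin n) : E →L[ℂ] PiLp 2 (fun _ : Fin n => E) :=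
  (PiLp.continuousLinearEquiv 2 ℂ (fun _ : Fin n => E)).symm.toContinuousLinearMap ∘L
    ContinuousLinearMap.single ℂ (fun _ : Fin n => E) k

theorem adjoint_hilbertSumInclusion_comp (n : ℕ) (j k : Fin n) :
    adjoint (hilbertSumInclusion E n j) ∘L hilbertSumInclusion E n k = if j = k then 1 else 0 := by
  ext u
  refine ext_inner_left ℂ fun v => ?_
  rw [comp_apply, adjoint_inner_right, PiLp.inner_apply, Finset.sum_eq_single j]
  · by_cases h : j = k
    · subst h; simp [hilbertSumInclusion]
    · simp [hilbertSumInclusion, h]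
  · intro i _ hij
    simp [hilbertSumInclusion, hij]
  · simp
end Embedding

section Implications
variable {E F : Type*} [NormedAddCommGroup E] [InnerProductSpace ℂ E] [CompleteSpace E]
  [NormedAddCommGroup F] [InnerProductSpace ℂ F] [CompleteSpace F] {f : ℝ → ℝ} {I : Set ℝ}

omit [CompleteSpace E] in
theorem nontrivial_of_not_finiteDimensional (hdim : ¬ FiniteDimensional ℂ E) : Nontrivial E := by
  by_contra h
  rw [not_nontrivial_iff_subsingleton] at h
  exact hdim inferInstance

theorem OperatorConvexOn.operatorConvexAt {H : Type} [NormedAddCommGroup H]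
    [InnerProductSpace ℂ H] [CompleteSpace H] (h : OperatorConvexOn f I)
    (hdim : ¬ FiniteDimensional ℂ H) : OperatorConvexAt f I H :=
  h H hdim

theorem OperatorConvexOn.sum_le {H : Type} [NormedAddCommGroup H]
    [InnerProductSpace ℂ H] [CompleteSpace H] (h : OperatorConvexOn f I) (hI : I.OrdConnected)
    (hf : ContinuousOn f I) (hdim : ¬ FiniteDimensional ℂ H) (n : ℕ) (x a : Fin n → H →L[ℂ] H)
    (hx : ∀ k, IsSelfAdjoint (x k)) (hs : ∀ k, spectrum ℝ (x k) ⊆ I)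
    (ha : ∑ k, star (a k) * a k = 1) :
    cfc f (∑ k, star (a k) * x k * a k) ≤ ∑ k, star (a k) * cfc f (x k) * a k := by
  have := nontrivial_of_not_finiteDimensional hdim
  rcases Nat.eq_zero_or_pos n with rfl | hn
  · simp at ha
  have : Nonempty (Fin n) := ⟨⟨0, hn⟩⟩
  have hw : ∀ k, adjoint (hilbertSumInclusion H n k) ∘L hilbertSumInclusion H n k = 1 := fun k => by
    rw [adjoint_hilbertSumInclusion_comp, if_pos rfl]
  have hdim' : ¬ FiniteDimensional ℂ (PiLp 2 (fun _ : Fin n => H)) := fun hfd => by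
    have hinj : Function.Injective (hilbertSumInclusion H n ⟨0, hn⟩) :=
      Function.LeftInverse.injective (g := adjoint (hilbertSumInclusion H n ⟨0, hn⟩))
        fun u => congrArg (fun T => T u) (hw ⟨0, hn⟩)
    exact hdim (FiniteDimensional.of_injective
      (hilbertSumInclusion H n ⟨0, hn⟩ : H →ₗ[ℂ] PiLp 2 (fun _ : Fin n => H)) hinj)
  have := nontrivial_of_not_finiteDimensional hdim'
  have hJ := ((h.operatorConvexAt hdim').isometricJensen (F := H) hI hf).sum_le hI hf
    (fun j k hjk => by rw [adjoint_hilbertSumInclusion_comp, if_neg hjk]) hw hx hs ha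
  simpa only [star_eq_adjoint, mul_def, comp_assoc] using hJ

theorem IsometricJensen.operatorConvexAt (hdim : ¬ FiniteDimensional ℂ E) (hI : I.OrdConnected)
    (hf : ContinuousOn f I) (h : IsometricJensen f I E E) : OperatorConvexAt f I E := by
  intro x y hx hy hsx hsy t ht
  have := nontrivial_of_not_finiteDimensional hdim
  obtain ⟨w, horth, hw⟩ := exists_orthogonal_isometries hdim
  have key : ∀ (r : ℝ), 0 ≤ r → ∀ T : E →L[ℂ] E,
      adjoint (Real.sqrt r • (1 : E →L[ℂ] E)) ∘L T ∘L (Real.sqrt r • 1) = r • T := fun r hr T => by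
    have : adjoint (Real.sqrt r • (1 : E →L[ℂ] E)) = Real.sqrt r • 1 :=
      isSelfAdjoint_iff'.1 ((IsSelfAdjoint.all _).smul (IsSelfAdjoint.one _))
    rw [this]
    simp only [← mul_def, smul_mul_assoc, mul_smul_comm, one_mul, mul_one, smul_smul,
      Real.mul_self_sqrt hr]
  have ht' : 0 ≤ 1 - t := sub_nonneg.2 ht.2
  have := h.sum_le hI hf horth hw (x := fun k => cond k x y)
    (a := fun k => cond k (Real.sqrt t • 1) (Real.sqrt (1 - t) • 1)) (by simp [hx, hy])
    (by simp [hsx, hsy]) (by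
      have h1 := key t ht.1 1
      have h2 := key (1 - t) ht' 1
      simp only [← mul_def, one_mul] at h1 h2
      simp only [Fintype.sum_bool, cond_true, cond_false, ← mul_def, h1, h2]
      module)
  simpa only [Fintype.sum_bool, cond_true, cond_false, key t ht.1, key _ ht'] using this

theorem IsometricJensen.of_pinching [Nontrivial E] (hI : I.OrdConnected) (hf : ContinuousOn f I)
    (h : ∀ p x : E →L[ℂ] E, IsSelfAdjoint p → p * p = p → IsSelfAdjoint x →
      spectrum ℝ x ⊆ I → ∀ s ∈ I, p * cfc f (p * x * p + s • (1 - p)) * p ≤ p * cfc f x * p) :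
    IsometricJensen f I E E := by
  intro v x hv hx hs
  obtain ⟨a, b, hab, hIcc, hs'⟩ := exists_Icc_of_spectrum_subset (ι := Unit) hI
    (x := fun _ => x) (fun _ => hx) (fun _ => hs)
  replace hs' := hs' ()
  have hvs : star v * v = 1 := hv
  have hpv : v * star v * v = v := by rw [mul_assoc, hvs, mul_one]
  have hvp : star v * (v * star v) = star v := by rw [← mul_assoc, hvs, one_mul]
  have hy : IsSelfAdjoint (star v * x * v) := hx.conjugate' v
  have hz : dilation (fun _ : Unit => v) a (fun _ => star v * x * v) =
      v * star v * x * (v * star v) + a • (1 - v * star v) := by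
    simp [dilation, complProj, mul_def, star_eq_adjoint, comp_assoc]
  have horth : ∀ j k : Unit, j ≠ k → adjoint v ∘L v = 0 := fun _ _ hjk => (hjk rfl).elim
  have hw : ∀ _ : Unit, v ∘L adjoint v ∘L v = v := fun _ => by rw [hv]; rfl
  have hys : spectrum ℝ (star v * x * v) ⊆ Set.Icc a b := by
    have := spectrum_adjoint_conj_subset hx hs' hv
    rwa [← comp_assoc] at this
  have hzv := dilation_comp horth hw a (x := fun _ => star v * x * v)
    (fun _ => by rw [hv]; rfl) ()
  have hfz := cfc_comp_of_intertwine (isSelfAdjoint_dilation fun _ => hy) hy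
    (spectrum_dilation_subset horth hw hab (fun _ => hy) fun _ => hys) hys (hf.mono hIcc) hzv
  rw [hz, ← mul_def, ← mul_def] at hfz
  have hp := h (v * star v) x (IsSelfAdjoint.mul_star_self v) (by rw [← mul_assoc, hpv]) hx hs a
    (hIcc ⟨le_rfl, hab⟩)
  have hc := star_left_conjugate_le_conjugate hp v
  have e1 : ∀ T : E →L[ℂ] E, star v * (v * star v * T * (v * star v)) * v = star v * T * v :=
    fun T => by
      calc _ = (star v * (v * star v)) * T * (v * star v * v) := by simp only [mul_assoc]
        _ = _ := by rw [hvp, hpv]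
  rw [e1, e1, mul_assoc, hfz, ← mul_assoc, hvs, one_mul] at hc
  simpa only [star_eq_adjoint, mul_def, comp_assoc] using hc

end Implications

/-- **Jensen's operator inequality (Theorem 2.1).**  For a continuous function `f` on an
interval `I ⊆ ℝ` and an infinite-dimensional complex Hilbert space `H`, the following are
equivalent: (i) `f` is operator convex on `I`; (ii) for each `n`, Jensen's operator inequality
`f(∑ aₖ* xₖ aₖ) ≤ ∑ aₖ* f(xₖ) aₖ` holds for all self-adjoint `xₖ` with spectra in `I` and all
`aₖ` with `∑ aₖ* aₖ = 1`; (iii) `f(v* x v) ≤ v* f(x) v` for every isometry `v`;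
(iv) the pinching inequality `p f(p x p + s(1 − p)) p ≤ p f(x) p` holds for every orthogonal
projection `p` and every `s ∈ I`. -/
theorem jensen_operator_inequality_tfae
    (f : ℝ → ℝ) (I : Set ℝ) (hI : I.OrdConnected) (hf : ContinuousOn f I)
    (H : Type) [NormedAddCommGroup H] [InnerProductSpace ℂ H] [CompleteSpace H]
    (hdim : ¬ FiniteDimensional ℂ H) :
    List.TFAE
      [OperatorConvexOn f I,
        ∀ (n : ℕ) (x a : Fin n → H →L[ℂ] H), (∀ k, IsSelfAdjoint (x k)) →
          (∀ k, spectrum ℝ (x k) ⊆ I) → ∑ k, star (a k) * a k = 1 →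
            cfc f (∑ k, star (a k) * x k * a k) ≤ ∑ k, star (a k) * cfc f (x k) * a k,
        ∀ v x : H →L[ℂ] H, star v * v = 1 → IsSelfAdjoint x → spectrum ℝ x ⊆ I →
          cfc f (star v * x * v) ≤ star v * cfc f x * v,
        ∀ p x : H →L[ℂ] H, IsSelfAdjoint p → p * p = p → IsSelfAdjoint x →
          spectrum ℝ x ⊆ I → ∀ s ∈ I,
            p * cfc f (p * x * p + s • (1 - p)) * p ≤ p * cfc f x * p] := by
  have := nontrivial_of_not_finiteDimensional hdim
  tfae_have 1 → 2 := fun h => h.sum_le hI hf hdim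
  tfae_have 2 → 3 := fun h v x hv hx hs => by
    simpa using h 1 (fun _ => x) (fun _ => v) (fun _ => hx) (fun _ => hs) (by simpa using hv)
  tfae_have 2 → 4 := fun h p x hp hpp hx hs s hsI => by
    have hqp : (1 - p) * p = 0 := by rw [sub_mul, hpp, one_mul, sub_self]
    have hqq : (1 - p) * (1 - p) = 1 - p := by rw [mul_sub, hqp, mul_one, sub_zero]
    have hq : star (1 - p) = 1 - p := ((IsSelfAdjoint.one _).sub hp).star_eq
    have hc := h 2 ![x, s • 1] ![p, 1 - p]
      (by simp [Fin.forall_fin_two, hx, (IsSelfAdjoint.all s).smul (IsSelfAdjoint.one (H →L[ℂ] H))])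
      (by
        rw [Fin.forall_fin_two]
        refine ⟨hs, ?_⟩
        simpa [← Algebra.algebraMap_eq_smul_one, spectrum.scalar_eq] using hsI)
      (by simp [Fin.sum_univ_two, hp.star_eq, hq, hpp, hqq])
    simp only [Fin.sum_univ_two, Matrix.cons_val_zero, Matrix.cons_val_one, hp.star_eq, hq,
      mul_smul_comm, smul_mul_assoc, mul_one, hqq] at hc
    have hc' := star_left_conjugate_le_conjugate hc p
    rw [hp.star_eq] at hc'
    refine hc'.trans (le_of_eq ?_)
    have h1 : p * (p * cfc f x * p) * p = (p * p) * cfc f x * (p * p) := by simp only [mul_assoc]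
    have h2 : p * ((1 - p) * cfc f (s • 1) * (1 - p)) * p =
        p * ((1 - p) * cfc f (s • 1)) * ((1 - p) * p) := by simp only [mul_assoc]
    rw [mul_add, add_mul, h1, h2, hpp, hqp, mul_zero, add_zero]
  tfae_have 4 → 3 := fun h v x hv hx hs => by
    simpa only [star_eq_adjoint, mul_def, comp_assoc] using
      IsometricJensen.of_pinching hI hf h v x hv hx hs
  tfae_have 3 → 1 := fun h => by
    have hJ : IsometricJensen f I H H := fun v x hv hx hs => by
      simpa only [star_eq_adjoint, mul_def, comp_assoc] using h v x hv hx hs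
    intro K _ _ _ hK
    have := nontrivial_of_not_finiteDimensional hK
    exact (hJ.operatorConvexAt hdim hI hf).of_partialIsometry hI hf
      fun x y hx hy ξ => exists_partialIsometry hdim hx hy ξ
  tfae_finish
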